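/- Let u be a solution of (E_ε) for some ε > 0. Then for every a ∈ (0,∞) the identity ∫_Ω [ (a+1)|∇u|² e^u/(a+e^u)² + ε^{-2} e^u (1−e^u)² / ((τ+e^u)³ (a+e^u)) ] dx = 4π (N₁/a + N₂) holds. -/

import Mathlib

open MeasureTheory Real Filter Set Metric Topology

noncomputable section

/-- The Euclidean plane `ℝ²`. -/
abbrev Pl := EuclideanSpace ℝ (Fin 2)

/-- The unit lattice `ℤ² ⊆ ℝ²`; the flat 2-torus `Ω` is its quotient, which we model by
working with doubly periodic functions on the plane. -/
def unitLattice : Set Pl :=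
  {v | ∃ a b : ℤ, v = (a : ℝ) • EuclideanSpace.single 0 (1:ℝ) +
      (b : ℝ) • EuclideanSpace.single 1 (1:ℝ)}

/-- A fundamental domain for the torus `Ω` (of total area `|Ω| = 1`). -/
def fund : Set Pl := {x | x 0 ∈ Ico (0:ℝ) 1 ∧ x 1 ∈ Ico (0:ℝ) 1}

/-- A doubly periodic function on the plane, i.e. a function on the torus `Ω`. -/
def Periodic2 (u : Pl → ℝ) : Prop := ∀ x : Pl, ∀ v ∈ unitLattice, u (x + v) = u x

/-- Partial derivative in the `i`-th coordinate direction. -/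
def pd (u : Pl → ℝ) (i : Fin 2) : Pl → ℝ :=
  fun x => lineDeriv ℝ u x (EuclideanSpace.single i (1:ℝ))

/-- The Laplacian `Δu`. -/
def lap (u : Pl → ℝ) (x : Pl) : ℝ := pd (pd u 0) 0 x + pd (pd u 1) 1 x

/-- `|∇u|²`. -/
def gradSq (u : Pl → ℝ) (x : Pl) : ℝ := (pd u 0 x) ^ 2 + (pd u 1 x) ^ 2

/-- The nonlinearity `f_τ(t) = e^t (1 − e^t) / (τ + e^t)³`. -/
def fτ (τ t : ℝ) : ℝ := exp t * (1 - exp t) / (τ + exp t) ^ 3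

/-- `f_τ'(t) = e^t (τ − 2(τ+1) e^t + e^{2t}) / (τ + e^t)⁴`. -/
def fτ' (τ t : ℝ) : ℝ := exp t * (τ - 2 * (τ + 1) * exp t + exp (2 * t)) / (τ + exp t) ^ 4

/-- The antiderivative `F_{2,τ}(t) = e^t ((1−τ) e^t + 2τ) / (2τ² (τ+e^t)²)` of `f_τ`. -/
def F2τ (τ t : ℝ) : ℝ := exp t * ((1 - τ) * exp t + 2 * τ) / (2 * τ ^ 2 * (τ + exp t) ^ 2)

/-- `u − 2a ln‖· − p‖` extends smoothly across `p`: this encodes the distributional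
equation `Δu = 4πa δ_p + (smooth)` near `p`. -/
def LogSing (u : Pl → ℝ) (p : Pl) (a : ℝ) : Prop :=
  ∃ r > 0, ∃ v : Pl → ℝ, ContDiffOn ℝ (⊤ : ℕ∞) v (ball p r) ∧
    ∀ x ∈ ball p r, x ≠ p → u x = 2 * a * Real.log ‖x - p‖ + v x

/-- The vortex data: distinct points `p_{j,1}` (`1 ≤ j ≤ d₁`), `p_{j,2}` (`1 ≤ j ≤ d₂`)
of the torus with multiplicities `m_{j,1} ≥ 0`, `m_{j,2} ≥ 0`. -/
structure VortexData where
  d₁ : ℕ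
  d₂ : ℕ
  p₁ : Fin d₁ → Pl
  p₂ : Fin d₂ → Pl
  m₁ : Fin d₁ → ℝ
  m₂ : Fin d₂ → ℝ
  m₁_nonneg : ∀ j, 0 ≤ m₁ j
  m₂_nonneg : ∀ j, 0 ≤ m₂ j
  distinct : ∀ i j : Fin d₁ ⊕ Fin d₂, i ≠ j → ∀ v ∈ unitLattice,
      Sum.elim p₁ p₂ i ≠ Sum.elim p₁ p₂ j + v

namespace VortexData
variable (V : VortexData)

/-- The set `Z₁` of vortex points `p_{j,1}` (viewed in the plane: all lattice translates). -/
def Z1 : Set Pl := {x | ∃ j v, v ∈ unitLattice ∧ x = V.p₁ j + v}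

/-- The set `Z₂` of vortex points `p_{j,2}` (viewed in the plane: all lattice translates). -/
def Z2 : Set Pl := {x | ∃ j v, v ∈ unitLattice ∧ x = V.p₂ j + v}

/-- The full vortex set `Z = Z₁ ∪ Z₂`. -/
def Z : Set Pl := V.Z1 ∪ V.Z2

/-- `N₁ = Σ_j m_{j,1}`. -/
def N1 : ℝ := ∑ j, V.m₁ j

/-- `N₂ = Σ_j m_{j,2}`. -/
def N2 : ℝ := ∑ j, V.m₂ j

end VortexData

/-- `u` is a solution of `(E_ε)`:
`Δu + ε⁻² f_τ(u) = 4π Σ_j m_{j,1} δ_{p_{j,1}} − 4π Σ_j m_{j,2} δ_{p_{j,2}}` on `Ω`,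
formulated classically: `u` is doubly periodic, smooth away from `Z`, solves the PDE
classically off `Z`, and has the prescribed logarithmic singularities at the vortices. -/
structure IsSolution (V : VortexData) (τ ε : ℝ) (u : Pl → ℝ) : Prop where
  periodic : Periodic2 u
  smooth : ContDiffOn ℝ (⊤ : ℕ∞) u (V.Z)ᶜ
  pde : ∀ x ∉ V.Z, lap u x + (ε ^ 2)⁻¹ * fτ τ (u x) = 0
  sing₁ : ∀ j, LogSing u (V.p₁ j) (V.m₁ j)
  sing₂ : ∀ j, LogSing u (V.p₂ j) (-(V.m₂ j))

/-- The quadratic form `∫_Ω |∇φ|² − ε⁻² f_τ'(u) φ²` of the linearized operator at `u`. -/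
def QuadForm (τ ε : ℝ) (u φ : Pl → ℝ) : ℝ :=
  ∫ x in fund, (gradSq φ x - (ε ^ 2)⁻¹ * fτ' τ (u x) * (φ x) ^ 2)

/-- `u` is a stable solution: the first eigenvalue `μ_ε` of the linearized operator is
nonnegative, i.e. the quadratic form is nonnegative on all (smooth, doubly periodic)
test functions. -/
def Stable (τ ε : ℝ) (u : Pl → ℝ) : Prop :=
  ∀ φ : Pl → ℝ, ContDiff ℝ (⊤ : ℕ∞) φ → Periodic2 φ → 0 ≤ QuadForm τ ε u φ

/-- `u` is strictly stable: the first eigenvalue `μ_ε` of the linearized operator is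
strictly positive. -/
def StrictlyStable (τ ε : ℝ) (u : Pl → ℝ) : Prop :=
  ∃ μ > 0, ∀ φ : Pl → ℝ, ContDiff ℝ (⊤ : ℕ∞) φ → Periodic2 φ →
    μ * (∫ x in fund, (φ x) ^ 2) ≤ QuadForm τ ε u φ


theorem mem_uL {v : Pl} : v ∈ unitLattice ↔ ∃ a b : ℤ, v 0 = a ∧ v 1 = b := by
  constructor
  · rintro ⟨a, b, rfl⟩
    exact ⟨a, b, by simp, by simp⟩
  · rintro ⟨a, b, h0, h1⟩
    refine ⟨a, b, ?_⟩
    ext i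
    fin_cases i <;> simp [h0, h1]

theorem uL_zero : (0 : Pl) ∈ unitLattice := mem_uL.2 ⟨0, 0, by simp, by simp⟩

theorem uL_add {v w : Pl} (hv : v ∈ unitLattice) (hw : w ∈ unitLattice) : v + w ∈ unitLattice := by
  obtain ⟨a, b, h0, h1⟩ := mem_uL.1 hv
  obtain ⟨c, d, h2, h3⟩ := mem_uL.1 hw
  exact mem_uL.2 ⟨a + c, b + d, by simp [h0, h2], by simp [h1, h3]⟩

theorem uL_neg {v : Pl} (hv : v ∈ unitLattice) : -v ∈ unitLattice := by
  obtain ⟨a, b, h0, h1⟩ := mem_uL.1 hv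
  exact mem_uL.2 ⟨-a, -b, by simp [h0], by simp [h1]⟩

theorem uL_sub {v w : Pl} (hv : v ∈ unitLattice) (hw : w ∈ unitLattice) : v - w ∈ unitLattice := by
  rw [sub_eq_add_neg]; exact uL_add hv (uL_neg hw)

theorem uL_single (i : Fin 2) : EuclideanSpace.single i (1:ℝ) ∈ unitLattice := by
  fin_cases i
  · exact mem_uL.2 ⟨1, 0, by simp, by simp⟩
  · exact mem_uL.2 ⟨0, 1, by simp, by simp⟩

theorem abs_coord_le (x : Pl) (i : Fin 2) : |x i| ≤ ‖x‖ := by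
  simpa using PiLp.norm_apply_le x i

theorem uL_small {v : Pl} (hv : v ∈ unitLattice) (h : ∀ i, |v i| < 1) : v = 0 := by
  obtain ⟨a, b, h0, h1⟩ := mem_uL.1 hv
  have ha := h 0
  have hb := h 1
  rw [h0] at ha
  rw [h1] at hb
  have ha' : a = 0 := by
    have : |a| < 1 := by
      have h2 : |(a:ℝ)| < 1 := ha
      exact_mod_cast h2
    exact Int.abs_lt_one_iff.1 this
  have hb' : b = 0 := by
    have : |b| < 1 := by
      have h2 : |(b:ℝ)| < 1 := hb
      exact_mod_cast h2
    exact Int.abs_lt_one_iff.1 this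
  ext i
  fin_cases i <;> simp [h0, h1, ha', hb']

theorem uL_norm {v : Pl} (hv : v ∈ unitLattice) (h0 : v ≠ 0) : 1 ≤ ‖v‖ := by
  by_contra! h
  exact h0 (uL_small hv fun i => (abs_coord_le v i).trans_lt h)

theorem uL_closed : IsClosed unitLattice := by
  have : unitLattice = (fun v : Pl => v 0) ⁻¹' (range ((↑) : ℤ → ℝ)) ∩
      (fun v : Pl => v 1) ⁻¹' (range ((↑) : ℤ → ℝ)) := by
    ext v
    rw [mem_uL]
    simp only [mem_inter_iff, mem_preimage, mem_range]
    constructor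
    · rintro ⟨a, b, h, h'⟩; exact ⟨⟨a, h.symm⟩, ⟨b, h'.symm⟩⟩
    · rintro ⟨⟨a, h⟩, ⟨b, h'⟩⟩; exact ⟨a, b, h.symm, h'.symm⟩
  rw [this]
  have hc : IsClosed (range ((↑) : ℤ → ℝ)) := Int.isClosedEmbedding_coe_real.isClosed_range
  exact (hc.preimage (by fun_prop)).inter (hc.preimage (by fun_prop))

theorem uL_countable : unitLattice.Countable := by
  have : unitLattice = range (fun p : ℤ × ℤ => (p.1 : ℝ) • EuclideanSpace.single (0 : Fin 2) (1:ℝ) +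
      (p.2 : ℝ) • EuclideanSpace.single (1 : Fin 2) (1:ℝ)) := by
    ext v
    simp only [unitLattice, mem_ofPred_eq, mem_range, Prod.exists]
    constructor
    · rintro ⟨a, b, h⟩; exact ⟨a, b, h.symm⟩
    · rintro ⟨a, b, h⟩; exact ⟨a, b, h.symm⟩
  rw [this]
  exact countable_range _

open scoped Pointwise in
theorem periodic_integral {F : Pl → ℝ} (hF : Periodic2 F) (c : Pl) :
    ∫ x in fund, F x = ∫ x in {x : Pl | x - c ∈ fund}, F x := by
  let b := (EuclideanSpace.basisFun (Fin 2) ℝ).toBasis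
  have hfd := ZSpan.isAddFundamentalDomain' b (volume : Measure Pl)
  have hfund : ZSpan.fundamentalDomain b = fund := by
    ext x
    simp [ZSpan.mem_fundamentalDomain, fund, b]
  rw [hfund] at hfd
  have hshift := hfd.vadd_of_comm (G' := Pl) c
  have hset : c +ᵥ fund = {x : Pl | x - c ∈ fund} := by
    ext x
    rw [Set.mem_vadd_set_iff_neg_vadd_mem]
    simp [sub_eq_add_neg, add_comm]
  rw [hset] at hshift
  have : Countable (Submodule.span ℤ (range b)).toAddSubgroup :=
    inferInstanceAs (Countable (Submodule.span ℤ (range b)))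
  refine hfd.setIntegral_eq hshift ?_
  rintro ⟨g, hg⟩ x
  have hgL : g ∈ unitLattice := by
    have hg' : g ∈ Submodule.span ℤ (range b) := hg
    refine Submodule.span_induction (p := fun y _ => y ∈ unitLattice) ?_ uL_zero
      (fun _ _ _ _ => uL_add) ?_ hg'
    · rintro _ ⟨i, rfl⟩
      simpa [b] using uL_single i
    · intro n y _ hy
      obtain ⟨p, q, h0, h1⟩ := mem_uL.1 hy
      exact mem_uL.2 ⟨n * p, n * q, by simp [h0], by simp [h1]⟩
  change F (g + x) = F x
  rw [add_comm]
  exact hF x g hgL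

theorem fund_meas : MeasurableSet fund := by
  have h0 : Measurable (fun x : Pl => x 0) := by fun_prop
  have h1 : Measurable (fun x : Pl => x 1) := by fun_prop
  exact (h0 measurableSet_Ico).inter (h1 measurableSet_Ico)

/-- pullback of `fund` -/
theorem fund_ae : (WithLp.toLp 2 : (Fin 2 → ℝ) → Pl) ⁻¹' fund =ᵐ[volume] Icc (0 : Fin 2 → ℝ) 1 := by
  have : (WithLp.toLp 2 : (Fin 2 → ℝ) → Pl) ⁻¹' fund = Set.pi univ fun i => Ico ((0 : Fin 2 → ℝ) i) ((1 : Fin 2 → ℝ) i) := by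
    ext x
    simp [fund, Fin.forall_fin_two]
  rw [this]
  exact Measure.univ_pi_Ico_ae_eq_Icc

theorem integral_fund (G : Pl → ℝ) :
    ∫ x in fund, G x = ∫ y in Icc (0 : Fin 2 → ℝ) 1, G (WithLp.toLp 2 y) := by
  rw [← setIntegral_congr_set fund_ae]
  exact ((PiLp.volume_preserving_toLp (Fin 2)).setIntegral_preimage_emb
    (MeasurableEquiv.toLp 2 (Fin 2 → ℝ)).measurableEmbedding G fund).symm

theorem integrableOn_fund {G : Pl → ℝ} :
    IntegrableOn G fund ↔ IntegrableOn (fun y : Fin 2 → ℝ => G (WithLp.toLp 2 y)) (Icc 0 1) := by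
  rw [← integrableOn_congr_set_ae fund_ae]
  exact ((PiLp.volume_preserving_toLp (Fin 2)).integrableOn_comp_preimage
    (MeasurableEquiv.toLp 2 (Fin 2 → ℝ)).measurableEmbedding).symm

theorem div_zero_int (F : Fin 2 → Pl → ℝ) (hper : ∀ i, Periodic2 (F i)) (hc : ∀ i, Continuous (F i))
    (S : Set Pl) (hS : S.Countable) (hd : ∀ x ∉ S, ∀ i, DifferentiableAt ℝ (F i) x)
    (hi : IntegrableOn (fun x => ∑ i, pd (F i) i x) fund) :
    ∫ x in fund, ∑ i, pd (F i) i x = 0 := by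
  let T : (Fin 2 → ℝ) →L[ℝ] Pl := (EuclideanSpace.equiv (Fin 2) ℝ).symm.toContinuousLinearMap
  have hT : ∀ y, T y = WithLp.toLp 2 y := fun y => rfl
  have hTe : ∀ i, T (Pi.single i 1) = EuclideanSpace.single i (1:ℝ) := by
    intro i; rw [hT]; rfl
  let S' : Set (Fin 2 → ℝ) := T ⁻¹' S
  have hS' : S'.Countable := hS.preimage_of_injOn (by
    intro x _ y _ h; exact (EuclideanSpace.equiv (Fin 2) ℝ).symm.injective h)
  have hae : ∀ᵐ y : Fin 2 → ℝ, y ∉ S' := by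
    have := hS'.measure_zero (volume : Measure (Fin 2 → ℝ))
    exact measure_eq_zero_iff_ae_notMem.1 this
  have heq : (fun y => ∑ i, ((fderiv ℝ (F i) (T y)).comp T) (Pi.single i 1)) =ᵐ[volume.restrict (Icc 0 1)]
      (fun y : Fin 2 → ℝ => ∑ i, pd (F i) i (WithLp.toLp 2 y)) := by
    filter_upwards [ae_restrict_of_ae hae] with y hy
    refine Finset.sum_congr rfl fun i _ => ?_
    rw [pd, ← hT, (hd (T y) hy i).lineDeriv_eq_fderiv]
    simp [hTe]
  rw [integral_fund, ← integral_congr_ae heq]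
  rw [integral_divergence_of_hasFDerivAt_off_countable' 0 1 (by intro i; simp)
    (fun i y => F i (T y)) (fun i y => (fderiv ℝ (F i) (T y)).comp T) S' hS'
    (fun i => ((hc i).comp T.continuous).continuousOn)
    (fun y hy i => ((hd (T y) hy.2 i).hasFDerivAt).comp y T.hasFDerivAt)
    ((integrableOn_fund.1 hi).congr heq.symm)]
  refine Finset.sum_eq_zero fun i _ => ?_
  rw [sub_eq_zero]
  refine integral_congr_ae (Eventually.of_forall fun y => ?_)
  have := hper i (T (i.insertNth 0 y)) _ (uL_single i)
  simp only [Pi.zero_apply, Pi.one_apply]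
  rw [← this, ← hTe, ← map_add]
  congr 2
  ext k
  refine Fin.succAboveCases i ?_ ?_ k <;> simp

/-- lattice translate -/
def lat (p : Pl) : Set Pl := {x | x - p ∈ unitLattice}

theorem mem_lat {p x : Pl} : x ∈ lat p ↔ x - p ∈ unitLattice := Iff.rfl

theorem self_lat (p : Pl) : p ∈ lat p := by
  rw [mem_lat, sub_self]; exact uL_zero

theorem lat_closed (p : Pl) : IsClosed (lat p) := by
  have : lat p = (fun x => x - p) ⁻¹' unitLattice := rfl
  rw [this]
  exact uL_closed.preimage (by fun_prop)

theorem lat_countable (p : Pl) : (lat p).Countable := by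
  have : lat p = (fun x => x - p) ⁻¹' unitLattice := rfl
  rw [this]
  exact uL_countable.preimage_of_injOn (sub_left_injective.injOn)

theorem lat_add {p x v : Pl} (hv : v ∈ unitLattice) : x + v ∈ lat p ↔ x ∈ lat p := by
  rw [mem_lat, mem_lat]
  constructor
  · intro h
    have := uL_sub h hv
    rwa [show x + v - p - v = x - p by abel] at this
  · intro h
    have := uL_add h hv
    rwa [show x - p + v = x + v - p by abel] at this

/-- distance to lattice translate -/
def dl (p x : Pl) : ℝ := infDist x (lat p)

theorem dl_cont (p : Pl) : Continuous (dl p) := continuous_infDist_pt _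

theorem dl_nonneg (p x : Pl) : 0 ≤ dl p x := infDist_nonneg

theorem dl_near {p x : Pl} {r : ℝ} (h : dl p x < r) : ∃ z ∈ lat p, ‖x - z‖ < r := by
  obtain ⟨z, hz, h⟩ := (infDist_lt_iff ⟨p, self_lat p⟩).1 h
  exact ⟨z, hz, by rwa [← dist_eq_norm]⟩

theorem dl_le {p x z : Pl} (hz : z ∈ lat p) : dl p x ≤ ‖x - z‖ := by
  rw [← dist_eq_norm]; exact infDist_le_dist_of_mem hz

theorem dl_eq {p x z : Pl} (hz : z ∈ lat p) (h : ‖x - z‖ < 1 / 2) : dl p x = ‖x - z‖ := by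
  refine le_antisymm (dl_le hz) ?_
  refine (le_infDist ⟨p, self_lat p⟩).2 fun {y} hy => ?_
  rw [dist_eq_norm]
  by_cases hyz : y = z
  · rw [hyz]
  · have hL : z - y ∈ unitLattice := by
      have := uL_sub (mem_lat.1 hz) (mem_lat.1 hy)
      rwa [show z - p - (y - p) = z - y by abel] at this
    have h1 := uL_norm hL (sub_ne_zero.2 (Ne.symm hyz))
    have h2 : ‖z - y‖ ≤ ‖x - y‖ + ‖x - z‖ := by
      rw [show z - y = (x - y) - (x - z) by abel]; exact norm_sub_le _ _
    linarith

theorem dl_per (p : Pl) : Periodic2 (dl p) := by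
  have key : ∀ x v, v ∈ unitLattice → dl p (x + v) ≤ dl p x := by
    intro x v hv
    refine (le_infDist ⟨p, self_lat p⟩).2 fun {y} hy => ?_
    rw [dist_eq_norm]
    have := dl_le (x := x + v) ((lat_add hv).2 hy)
    rwa [show x + v - (y + v) = x - y by abel] at this
  intro x v hv
  refine le_antisymm (key x v hv) ?_
  have := key (x + v) (-v) (uL_neg hv)
  rwa [show x + v + -v = x by abel] at this

theorem dl_pos {p x : Pl} (h : x ∉ lat p) : 0 < dl p x :=
  ((lat_closed p).notMem_iff_infDist_pos ⟨p, self_lat p⟩).1 h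

theorem sqmax_deriv (t : ℝ) :
    HasDerivAt (fun t : ℝ => (max (1 - t) 0) ^ 2) (-2 * max (1 - t) 0) t := by
  rcases lt_trichotomy t 1 with h | h | h
  · have h1 : HasDerivAt (fun t : ℝ => (1 - t) ^ 2) (-2 * max (1 - t) 0) t := by
      rw [max_eq_left (by linarith)]
      have := ((hasDerivAt_id t).const_sub 1).pow 2
      convert! this using 1
      simp
    refine h1.congr_of_eventuallyEq ?_
    filter_upwards [Iio_mem_nhds h] with s hs
    rw [max_eq_left (by have : s < 1 := hs; linarith)]
  · subst h
    simp only [sub_self, max_self, mul_zero]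
    rw [hasDerivAt_iff_isLittleO]
    simp only [sub_self, max_self, ne_eq, OfNat.ofNat_ne_zero, not_false_eq_true, zero_pow,
      sub_zero, smul_zero]
    have h2 : (fun x' : ℝ => (max (1 - x') 0) ^ 2) =O[𝓝 1] fun x' => (x' - 1) ^ 2 := by
      refine Asymptotics.IsBigO.of_bound 1 (Eventually.of_forall fun x => ?_)
      rw [one_mul, norm_pow, norm_pow]
      gcongr
      rw [Real.norm_eq_abs, Real.norm_eq_abs, abs_of_nonneg (le_max_right _ _), abs_sub_comm]
      exact max_le (le_abs_self _) (abs_nonneg _)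
    refine h2.trans_isLittleO ?_
    have h3 : (fun x' : ℝ => x' - 1) =o[𝓝 1] fun _ => (1 : ℝ) := by
      rw [Asymptotics.isLittleO_one_iff]
      have : Continuous (fun x : ℝ => x - 1) := by fun_prop
      simpa using this.tendsto 1
    have := h3.mul_isBigO (Asymptotics.isBigO_refl (fun x' : ℝ => x' - 1) (𝓝 1))
    simpa [pow_two] using this
  · have h1 : HasDerivAt (fun _ : ℝ => (0 : ℝ)) (-2 * max (1 - t) 0) t := by
      rw [max_eq_right (by linarith), mul_zero]
      exact hasDerivAt_const _ _
    refine h1.congr_of_eventuallyEq ?_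
    filter_upwards [Ioi_mem_nhds h] with s hs
    rw [max_eq_right (by have : 1 < s := hs; linarith)]; simp

/-- the peak function -/
def phi (δ : ℝ) (y : Pl) : ℝ := 4 / δ * max (1 - ‖y‖ ^ 2 / δ) 0

theorem phi_nonneg {δ : ℝ} (hδ : 0 < δ) (y : Pl) : 0 ≤ phi δ y := by
  unfold phi
  have := le_max_right (1 - ‖y‖ ^ 2 / δ) 0
  positivity

theorem phi_cont (δ : ℝ) : Continuous (phi δ) := by unfold phi; fun_prop

theorem phi_zero {δ : ℝ} (hδ : 0 < δ) {y : Pl} (h : δ ≤ ‖y‖ ^ 2) : phi δ y = 0 := by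
  unfold phi
  have : 1 ≤ ‖y‖ ^ 2 / δ := by rwa [le_div_iff₀ hδ, one_mul]
  rw [max_eq_right (by linarith), mul_zero]

theorem phi_le {δ : ℝ} (hδ : 0 < δ) (y : Pl) : phi δ y ≤ 4 / δ := by
  unfold phi
  have : max (1 - ‖y‖ ^ 2 / δ) 0 ≤ 1 := max_le (by
    have : 0 ≤ ‖y‖ ^ 2 / δ := by positivity
    linarith) zero_le_one
  have h4 : 0 ≤ 4 / δ := by positivity
  nlinarith

theorem phi_integral {δ : ℝ} (hδ : 0 < δ) : ∫ y, phi δ y = 2 * π := by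
  have h1 : ∫ y, phi δ y = ∫ y : Pl, (fun r : ℝ => 4 / δ * max (1 - r ^ 2 / δ) 0) ‖y‖ := rfl
  rw [h1, integral_fun_norm_addHaar (volume : Measure Pl) (fun r : ℝ => 4 / δ * max (1 - r ^ 2 / δ) 0)]
  have hder : ∀ x : ℝ, HasDerivAt (fun r : ℝ => -(max (1 - r ^ 2 / δ) 0) ^ 2)
      (x * (4 / δ * max (1 - x ^ 2 / δ) 0)) x := by
    intro x
    have h2 : HasDerivAt (fun r : ℝ => r ^ 2 / δ) (2 * x / δ) x := by
      have := (hasDerivAt_pow 2 x).div_const δ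
      simpa using this
    have := ((sqmax_deriv (x ^ 2 / δ)).comp x h2).neg
    convert! this using 1
    ring
  have hlim : Tendsto (fun r : ℝ => -(max (1 - r ^ 2 / δ) 0) ^ 2) atTop (𝓝 0) := by
    refine tendsto_const_nhds.congr' ?_
    have : Tendsto (fun r : ℝ => r ^ 2 / δ) atTop atTop :=
      (tendsto_pow_atTop two_ne_zero).atTop_div_const hδ
    filter_upwards [this.eventually_ge_atTop 1] with r hr
    rw [max_eq_right (by linarith)]; simp
  have := integral_Ioi_of_hasDerivAt_of_nonneg' (a := 0) (fun x _ => hder x) (fun x hx => by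
    have h3 := le_max_right (1 - x ^ 2 / δ) 0
    have h4 : 0 < x := hx
    positivity) hlim
  simp only [finrank_euclideanSpace, Fintype.card_fin, smul_eq_mul]
  norm_num at this ⊢
  rw [this, measureReal_def, EuclideanSpace.volume_ball_fin_two]
  simp [pi_nonneg]

/-- The periodic bump. -/
def bb (p : Pl) (δ : ℝ) (x : Pl) : ℝ := (max (1 - dl p x ^ 2 / δ) 0) ^ 2

theorem bb_cont (p : Pl) (δ : ℝ) : Continuous (bb p δ) := by
  unfold bb
  have := dl_cont p
  fun_prop

theorem bb_per (p : Pl) (δ : ℝ) : Periodic2 (bb p δ) := by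
  intro x v hv
  unfold bb
  rw [dl_per p x v hv]

theorem bb_zero {p x : Pl} {δ : ℝ} (hδ : 0 < δ) (h : δ ≤ dl p x ^ 2) : bb p δ x = 0 := by
  unfold bb
  have : 1 ≤ dl p x ^ 2 / δ := by rwa [le_div_iff₀ hδ, one_mul]
  rw [max_eq_right (by linarith)]; simp

theorem bb_nonneg (p x : Pl) (δ : ℝ) : 0 ≤ bb p δ x := sq_nonneg _

theorem bb_le_one {p x : Pl} {δ : ℝ} (hδ : 0 < δ) : bb p δ x ≤ 1 := by
  unfold bb
  refine pow_le_one₀ (le_max_right _ _) (max_le ?_ zero_le_one)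
  have : 0 ≤ dl p x ^ 2 / δ := by positivity
  linarith

theorem bb_lower {p x : Pl} {δ : ℝ} (hδ : 0 < δ) : 1 - bb p δ x ≤ 2 * dl p x ^ 2 / δ := by
  unfold bb
  have h0 : 0 ≤ dl p x ^ 2 / δ := by positivity
  have h1 := le_max_left (1 - dl p x ^ 2 / δ) 0
  have h2 := le_max_right (1 - dl p x ^ 2 / δ) 0
  rw [mul_div_assoc]
  set s := dl p x ^ 2 / δ
  set m := max (1 - s) 0
  by_cases hs : s ≤ 1
  · nlinarith [mul_le_mul h1 h1 (by linarith) h2]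
  · nlinarith

theorem bb_mono {p x : Pl} {δ δ' : ℝ} (hδ : 0 < δ) (h : δ ≤ δ') : bb p δ x ≤ bb p δ' x := by
  unfold bb
  have : dl p x ^ 2 / δ' ≤ dl p x ^ 2 / δ := by gcongr
  gcongr

theorem bb_deriv {p x z : Pl} {δ : ℝ} (hz : z ∈ lat p) (h : ‖x - z‖ < 1 / 2) :
    HasFDerivAt (bb p δ) (-(phi δ (x - z)) • (innerSL ℝ (x - z) : Pl →L[ℝ] ℝ)) x := by
  have h1 : HasFDerivAt (fun y : Pl => ‖y - z‖ ^ 2 / δ)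
      ((2 / δ) • (innerSL ℝ (x - z) : Pl →L[ℝ] ℝ)) x := by
    have h2 := ((hasFDerivAt_id x).sub_const z).norm_sq.mul_const (δ⁻¹)
    simp only [← div_eq_mul_inv] at h2
    convert! h2 using 1
    ext y
    simp
    ring
  have h3 := (sqmax_deriv (‖x - z‖ ^ 2 / δ)).comp_hasFDerivAt x h1
  have h4 : (bb p δ) =ᶠ[𝓝 x] ((fun t : ℝ => (max (1 - t) 0) ^ 2) ∘ fun y : Pl => ‖y - z‖ ^ 2 / δ) := by
    have : ∀ᶠ y in 𝓝 x, ‖y - z‖ < 1 / 2 := by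
      have hc : Continuous (fun y : Pl => ‖y - z‖) := by fun_prop
      exact hc.tendsto x |>.eventually_lt_const h
    filter_upwards [this] with y hy
    simp only [bb, Function.comp, dl_eq hz hy]
  refine (h3.congr_of_eventuallyEq h4).congr_fderiv ?_
  rw [smul_smul, phi]
  congr 1
  ring

theorem bb_deriv_zero {p x : Pl} {δ : ℝ} (hδ : 0 < δ) (hδ' : δ < 1 / 4) (h : 1 / 2 ≤ dl p x) :
    HasFDerivAt (bb p δ) (0 : Pl →L[ℝ] ℝ) x := by
  refine (hasFDerivAt_const (0 : ℝ) x).congr_of_eventuallyEq ?_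
  have h1 : ∀ᶠ y in 𝓝 x, δ < dl p y ^ 2 :=
    (((dl_cont p).pow 2).tendsto x).eventually_const_lt (by
        change δ < dl p x ^ 2; nlinarith)
  filter_upwards [h1] with y hy
  exact bb_zero hδ hy.le

theorem bb_diff {p x : Pl} {δ : ℝ} (hδ : 0 < δ) (hδ' : δ < 1 / 4) :
    DifferentiableAt ℝ (bb p δ) x := by
  rcases lt_or_ge (dl p x) (1 / 2) with h | h
  · obtain ⟨z, hz, hx⟩ := dl_near h
    exact (bb_deriv hz hx).differentiableAt
  · exact (bb_deriv_zero hδ hδ' h).differentiableAt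

theorem pd_eq {f : Pl → ℝ} {x : Pl} (i : Fin 2) (h : DifferentiableAt ℝ f x) :
    pd f i x = fderiv ℝ f x (EuclideanSpace.single i 1) := h.lineDeriv_eq_fderiv

theorem pd_of {f : Pl → ℝ} {f' : Pl →L[ℝ] ℝ} {x : Pl} (i : Fin 2) (h : HasFDerivAt f f' x) :
    pd f i x = f' (EuclideanSpace.single i 1) := by
  rw [pd_eq i h.differentiableAt, h.fderiv]

theorem bb_pd {p x z : Pl} {δ : ℝ} (hz : z ∈ lat p) (h : ‖x - z‖ < 1 / 2) (i : Fin 2) :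
    pd (bb p δ) i x = -(phi δ (x - z)) * (x i - z i) := by
  rw [pd_of i (bb_deriv hz h)]
  simp [EuclideanSpace.inner_single_right]

theorem bb_pd_zero {p x : Pl} {δ : ℝ} (hδ : 0 < δ) (hδ' : δ < 1 / 4) (h : 1 / 2 ≤ dl p x)
    (i : Fin 2) : pd (bb p δ) i x = 0 := by
  rw [pd_of i (bb_deriv_zero hδ hδ' h)]
  simp

theorem bb_pd_cont {p : Pl} {δ : ℝ} (hδ : 0 < δ) (hδ' : δ < 1 / 4) (i : Fin 2) :
    Continuous (pd (bb p δ) i) := by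
  rw [continuous_iff_continuousAt]
  intro x
  rcases lt_or_ge (dl p x) (1 / 2) with h | h
  · obtain ⟨z, hz, hx⟩ := dl_near h
    have : ∀ᶠ y in 𝓝 x, ‖y - z‖ < 1 / 2 := by
      have hc : Continuous (fun y : Pl => ‖y - z‖) := by fun_prop
      exact hc.tendsto x |>.eventually_lt_const hx
    have hc : Continuous (fun y : Pl => -(phi δ (y - z)) * (y i - z i)) := by
      have := phi_cont δ
      fun_prop
    refine hc.continuousAt.congr ?_
    filter_upwards [this] with y hy
    exact (bb_pd hz hy i).symm
  · have h1 : ∀ᶠ y in 𝓝 x, δ < dl p y ^ 2 :=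
      (((dl_cont p).pow 2).tendsto x).eventually_const_lt (by
        change δ < dl p x ^ 2; nlinarith)
    refine (continuousAt_const (y := (0:ℝ))).congr ?_
    filter_upwards [h1] with y hy
    rcases lt_or_ge (dl p y) (1 / 2) with h | h
    · obtain ⟨z, hz, hx⟩ := dl_near h
      rw [bb_pd hz hx, phi_zero hδ (by rw [← dl_eq hz hx]; exact hy.le)]
      simp
    · exact (bb_pd_zero hδ hδ' h i).symm

theorem pd_per {f : Pl → ℝ} (hf : Periodic2 f) (i : Fin 2) : Periodic2 (pd f i) := by
  intro x v hv
  simp only [pd, lineDeriv]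
  congr 1
  ext t
  rw [show x + v + t • EuclideanSpace.single i (1:ℝ) = x + t • EuclideanSpace.single i (1:ℝ) + v by abel]
  exact hf _ v hv

theorem LogSing.translate {u : Pl → ℝ} (hu : Periodic2 u) {p : Pl} {α : ℝ} (h : LogSing u p α)
    {z : Pl} (hz : z ∈ lat p) : LogSing u z α := by
  obtain ⟨r, hr, v, hv, heq⟩ := h
  have hmap : ∀ x, x ∈ ball z r → x - (z - p) ∈ ball p r := by
    intro x hx
    rw [mem_ball, dist_eq_norm] at hx ⊢
    rwa [show x - (z - p) - p = x - z by abel]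
  refine ⟨r, hr, fun x => v (x - (z - p)), ?_, ?_⟩
  · exact hv.comp (contDiff_id.sub contDiff_const).contDiffOn hmap
  · intro x hx hne
    have h1 := heq (x - (z - p)) (hmap x hx) (by
      intro h; apply hne
      have := sub_eq_iff_eq_add.1 h
      rw [this]; abel)
    have h2 := hu (x - (z - p)) (z - p) hz
    rw [show x - (z - p) + (z - p) = x by abel] at h2
    rw [h2, h1, show x - (z - p) - p = x - z by abel]

theorem log_deriv {x z : Pl} (h : x ≠ z) : HasFDerivAt (fun y : Pl => Real.log ‖y - z‖)
    ((1 / ‖x - z‖ ^ 2) • (innerSL ℝ (x - z) : Pl →L[ℝ] ℝ)) x := by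
  have hne : ‖x - z‖ ≠ 0 := norm_ne_zero_iff.2 (sub_ne_zero.2 h)
  have h1 := ((hasFDerivAt_id x).sub_const z).norm_sq
  have h2 := (h1.log (pow_ne_zero 2 hne)).const_mul (1/2 : ℝ)
  have h3 : (fun y : Pl => Real.log ‖y - z‖) = fun y : Pl => (1/2 : ℝ) * Real.log (‖id y - z‖ ^ 2) := by
    ext y
    rw [Real.log_pow]; simp
  rw [h3]
  refine h2.congr_fderiv ?_
  ext y
  simp
  ring

/-- regular part data -/
theorem sing_data {u : Pl → ℝ} {z : Pl} {α : ℝ} (h : LogSing u z α) :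
    ∃ v : Pl → ℝ, ContinuousAt v z ∧ (∀ i, ContinuousAt (pd v i) z) ∧
      ∀ᶠ x in 𝓝[≠] z, u x = 2 * α * Real.log ‖x - z‖ + v x ∧
        ∀ i, pd u i x = 2 * α * ((x i - z i) / ‖x - z‖ ^ 2) + pd v i x := by
  obtain ⟨r, hr, v, hv, heq⟩ := h
  have hdv : ∀ x ∈ ball z r, DifferentiableAt ℝ v x := fun x hx =>
    ((hv x hx).contDiffAt (isOpen_ball.mem_nhds hx)).differentiableAt (by simp)
  refine ⟨v, (hdv z (mem_ball_self hr)).continuousAt, ?_, ?_⟩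
  · intro i
    have h1 : ContinuousOn (fderiv ℝ v) (ball z r) :=
      hv.continuousOn_fderiv_of_isOpen isOpen_ball (by simp)
    have h2 : ContinuousAt (fun x => fderiv ℝ v x (EuclideanSpace.single i 1)) z :=
      (h1.continuousAt (ball_mem_nhds z hr)).clm_apply continuousAt_const
    refine h2.congr ?_
    filter_upwards [ball_mem_nhds z hr] with x hx
    exact (pd_eq i (hdv x hx)).symm
  · filter_upwards [mem_nhdsWithin_of_mem_nhds (ball_mem_nhds z hr), self_mem_nhdsWithin] with x hx hne
    have hne : x ≠ z := hne
    refine ⟨heq x hx hne, fun i => ?_⟩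
    have h1 : HasFDerivAt (fun y : Pl => 2 * α * Real.log ‖y - z‖ + v y) _ x :=
      ((log_deriv hne).const_mul (2 * α)).add (hdv x hx).hasFDerivAt
    have h2 : u =ᶠ[𝓝 x] (fun y : Pl => 2 * α * Real.log ‖y - z‖ + v y) := by
      filter_upwards [isOpen_ball.mem_nhds hx, isOpen_ne.mem_nhds hne] with y hy hyne
      exact heq y hy hyne
    rw [pd_of i (h1.congr_of_eventuallyEq h2), pd_eq i (hdv x hx)]
    simp [EuclideanSpace.inner_single_right]
    left; ring

theorem sing_bound {u : Pl → ℝ} {z : Pl} {α : ℝ} (h : LogSing u z α) :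
    ∃ C, 0 ≤ C ∧ ∀ᶠ x in 𝓝[≠] z, ∀ i, ‖x - z‖ * |pd u i x| ≤ C := by
  obtain ⟨v, -, hv, hev⟩ := sing_data h
  have hb : ∃ M, 0 ≤ M ∧ ∀ᶠ x in 𝓝 z, ∀ i, |pd v i x| ≤ M := by
    refine ⟨max (|pd v 0 z| + 1) (|pd v 1 z| + 1), by positivity, ?_⟩
    have h0 := (hv 0).abs.eventually_lt_const (lt_add_one (|pd v 0 z|))
    have h1 := (hv 1).abs.eventually_lt_const (lt_add_one (|pd v 1 z|))
    filter_upwards [h0, h1] with x h0 h1 i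
    fin_cases i
    · exact le_max_of_le_left h0.le
    · exact le_max_of_le_right h1.le
  obtain ⟨M, hM0, hM⟩ := hb
  refine ⟨2 * |α| + M, by positivity, ?_⟩
  filter_upwards [hev, mem_nhdsWithin_of_mem_nhds hM,
    mem_nhdsWithin_of_mem_nhds (ball_mem_nhds z one_pos), self_mem_nhdsWithin] with x hx hMx hb hne i
  have hne : x ≠ z := hne
  have hpos : 0 < ‖x - z‖ := norm_pos_iff.2 (sub_ne_zero.2 hne)
  have hlt : ‖x - z‖ < 1 := by rwa [mem_ball, dist_eq_norm] at hb
  rw [hx.2 i]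
  have h1 : |x i - z i| ≤ ‖x - z‖ := by simpa using abs_coord_le (x - z) i
  have h2 : |2 * α * ((x i - z i) / ‖x - z‖ ^ 2)| ≤ 2 * |α| / ‖x - z‖ := by
    rw [abs_mul, abs_mul, abs_div, abs_of_pos (by positivity : (0:ℝ) < ‖x - z‖ ^ 2), abs_two,
      mul_div_assoc]
    rw [mul_assoc]
    gcongr 2 * ?_
    rw [div_eq_mul_inv |α|]
    gcongr
    rw [div_le_iff₀ (by positivity), pow_two, inv_mul_cancel_left₀ hpos.ne']
    exact h1
  calc ‖x - z‖ * |2 * α * ((x i - z i) / ‖x - z‖ ^ 2) + pd v i x|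
      ≤ ‖x - z‖ * (2 * |α| / ‖x - z‖ + M) := by
        gcongr
        exact (abs_add_le _ _).trans (add_le_add h2 (hMx i))
    _ = 2 * |α| + ‖x - z‖ * M := by field_simp
    _ ≤ _ := by nlinarith

theorem sing_radial {u : Pl → ℝ} {z : Pl} {α : ℝ} (h : LogSing u z α) :
    Tendsto (fun x => ∑ i, (x i - z i) * pd u i x) (𝓝[≠] z) (𝓝 (2 * α)) := by
  obtain ⟨v, -, hv, hev⟩ := sing_data h
  have h1 : Tendsto (fun x : Pl => 2 * α + ∑ i, (x i - z i) * pd v i x) (𝓝 z)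
      (𝓝 (2 * α + ∑ i, (z i - z i) * pd v i z)) := by
    refine tendsto_const_nhds.add (tendsto_finsetSum _ fun i _ => ?_)
    have hc : Continuous (fun x : Pl => x i - z i) := by fun_prop
    exact (hc.tendsto z).mul (hv i)
  simp only [sub_self, zero_mul, Finset.sum_const_zero, add_zero] at h1
  refine (h1.mono_left nhdsWithin_le_nhds).congr' ?_
  filter_upwards [hev, self_mem_nhdsWithin] with x hx hne
  have hne : x ≠ z := hne
  have hpos : 0 < ‖x - z‖ := norm_pos_iff.2 (sub_ne_zero.2 hne)
  have hn : ‖x - z‖ ^ 2 = (x 0 - z 0) ^ 2 + (x 1 - z 1) ^ 2 := by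
    rw [EuclideanSpace.norm_sq_eq]; simp
  simp only [Fin.sum_univ_two, hx.2]
  have h5 : (x 0 - z 0) * ((x 0 - z 0) / ‖x - z‖ ^ 2) + (x 1 - z 1) * ((x 1 - z 1) / ‖x - z‖ ^ 2) = 1 := by
    field_simp
    exact hn.symm
  linear_combination (-2 * α) * h5

/-- the multiplier -/
def gg (a t : ℝ) : ℝ := (1 - exp t) / (a + exp t)

theorem gg_bound {a : ℝ} (ha : 0 < a) (t : ℝ) : |gg a t| ≤ 1 + 1 / a := by
  unfold gg
  have hE := exp_pos t
  rw [abs_div, abs_of_pos (by positivity : 0 < a + exp t), div_le_iff₀ (by positivity)]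
  have h1 : (1 + 1 / a) * (a + exp t) = a + 1 + exp t + exp t / a := by field_simp; ring
  rw [h1]
  have : 0 < exp t / a := by positivity
  rw [abs_le]
  constructor <;> linarith

theorem gg_bot {a : ℝ} (ha : 0 < a) : Tendsto (gg a) atBot (𝓝 (1 / a)) := by
  have h := tendsto_exp_atBot
  have := (h.const_sub 1).div (h.const_add a) (by simpa using ha.ne')
  have h2 : gg a = (fun x => 1 - rexp x) / fun x => a + rexp x := rfl
  rw [h2]
  simpa using this

theorem gg_top {a : ℝ} (ha : 0 < a) : Tendsto (gg a) atTop (𝓝 (-1)) := by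
  have h : Tendsto (fun t : ℝ => a + exp t) atTop atTop := tendsto_atTop_add_const_left _ _ tendsto_exp_atTop
  have h2 := ((tendsto_const_nhds (x := (1 + a))).div_atTop h).const_add (-1)
  rw [add_zero] at h2
  refine h2.congr fun t => ?_
  have hE := exp_pos t
  unfold gg
  field_simp
  ring

theorem log_bot (z : Pl) : Tendsto (fun x : Pl => Real.log ‖x - z‖) (𝓝[≠] z) atBot := by
  refine Real.tendsto_log_nhdsGT_zero.comp ?_
  exact tendsto_norm_sub_self_nhdsNE z

theorem flux_zero {u : Pl → ℝ} {z : Pl} {a : ℝ} (ha : 0 < a) (h : LogSing u z 0) :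
    Tendsto (fun x => gg a (u x) * ∑ i, (x i - z i) * pd u i x) (𝓝[≠] z) (𝓝 0) := by
  have h1 := sing_radial h
  rw [mul_zero] at h1
  exact bdd_le_mul_tendsto_zero' (1 + 1 / a) (Eventually.of_forall fun x => gg_bound ha _) h1

theorem flux_one {u : Pl → ℝ} {z : Pl} {a m : ℝ} (ha : 0 < a) (hm : 0 ≤ m) (h : LogSing u z m) :
    Tendsto (fun x => gg a (u x) * ∑ i, (x i - z i) * pd u i x) (𝓝[≠] z) (𝓝 (2 * m / a)) := by
  rcases hm.eq_or_lt with rfl | hm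
  · simpa using flux_zero ha h
  · obtain ⟨v, hv, -, hev⟩ := sing_data h
    have h1 : Tendsto u (𝓝[≠] z) atBot := by
      have h2 : Tendsto (fun x : Pl => 2 * m * Real.log ‖x - z‖ + v x) (𝓝[≠] z) atBot :=
        tendsto_atBot_add_right_of_ge' _ (v z + 1) ((log_bot z).const_mul_atBot (by positivity)) (by
          have := (hv.tendsto.mono_left (nhdsWithin_le_nhds (s := {z}ᶜ))).eventually_lt_const (lt_add_one (v z))
          filter_upwards [this] with x hx using hx.le)
      exact h2.congr' (by filter_upwards [hev] with x hx using hx.1.symm)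
    have h3 := ((gg_bot ha).comp h1).mul (sing_radial h)
    rw [show 1 / a * (2 * m) = 2 * m / a by ring] at h3
    exact h3

theorem flux_two {u : Pl → ℝ} {z : Pl} {a m : ℝ} (ha : 0 < a) (hm : 0 ≤ m) (h : LogSing u z (-m)) :
    Tendsto (fun x => gg a (u x) * ∑ i, (x i - z i) * pd u i x) (𝓝[≠] z) (𝓝 (2 * m)) := by
  rcases hm.eq_or_lt with rfl | hm
  · rw [neg_zero] at h
    simpa using flux_zero ha h
  · obtain ⟨v, hv, -, hev⟩ := sing_data h
    have h1 : Tendsto u (𝓝[≠] z) atTop := by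
      have h2 : Tendsto (fun x : Pl => 2 * (-m) * Real.log ‖x - z‖ + v x) (𝓝[≠] z) atTop :=
        tendsto_atTop_add_right_of_le' _ (v z - 1)
          ((log_bot z).const_mul_atBot_of_neg (by linarith)) (by
          have := (hv.tendsto.mono_left (nhdsWithin_le_nhds (s := {z}ᶜ))).eventually_const_lt (sub_one_lt (v z))
          filter_upwards [this] with x hx using hx.le)
      exact h2.congr' (by filter_upwards [hev] with x hx using hx.1.symm)
    have h3 := ((gg_top ha).comp h1).mul (sing_radial h)
    rw [show (-1) * (2 * -m) = 2 * m by ring] at h3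
    exact h3

theorem bb_pd_zero' {p x : Pl} {δ : ℝ} (hδ : 0 < δ) (hδ' : δ < 1 / 4) (h : δ ≤ dl p x ^ 2)
    (i : Fin 2) : pd (bb p δ) i x = 0 := by
  rcases lt_or_ge (dl p x) (1 / 2) with h' | h'
  · obtain ⟨z, hz, hx⟩ := dl_near h'
    rw [bb_pd hz hx, phi_zero hδ (by rw [← dl_eq hz hx]; exact h)]
    simp
  · exact bb_pd_zero hδ hδ' h' i

theorem meas_of_contOn {S : Set Pl} (hS : IsClosed S) (hSc : S.Countable) {f : Pl → ℝ}
    (hf : ContinuousOn f Sᶜ) : AEStronglyMeasurable f volume := by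
  have h := hf.aestronglyMeasurable (μ := volume) hS.isOpen_compl.measurableSet
  rwa [Measure.restrict_eq_self_of_ae_mem] at h
  exact measure_eq_zero_iff_ae_notMem.1 (hSc.measure_zero volume)

theorem int_at {f : Pl → ℝ} (hf : AEStronglyMeasurable f volume) {z : Pl}
    (hb : ∃ C, ∀ᶠ x in 𝓝[≠] z, |f x| ≤ C) : IntegrableAtFilter f (𝓝 z) volume := by
  obtain ⟨C, hC⟩ := hb
  refine (Measure.finiteAt_nhds volume z).integrableAtFilter hf.stronglyMeasurableAtFilter ?_
  refine ⟨max C |f z|, ?_⟩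
  rw [eventually_map]
  rw [eventually_nhdsWithin_iff] at hC
  filter_upwards [hC] with x hx
  by_cases h : x = z
  · rw [h]; exact le_max_right _ _
  · exact le_max_of_le_left (hx h)

theorem fund_subset : fund ⊆ closedBall (0 : Pl) 2 := by
  intro x hx
  obtain ⟨⟨h0, h1⟩, ⟨h2, h3⟩⟩ := hx
  rw [mem_closedBall_zero_iff]
  have hn : ‖x‖ ^ 2 = (x 0) ^ 2 + (x 1) ^ 2 := by
    rw [EuclideanSpace.norm_sq_eq]; simp
  nlinarith [norm_nonneg x]

theorem int_fund {S : Set Pl} (hS : IsClosed S) (hSc : S.Countable) {f : Pl → ℝ}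
    (hf : ContinuousOn f Sᶜ) (hb : ∀ z ∈ S, ∃ C, ∀ᶠ x in 𝓝[≠] z, |f x| ≤ C) :
    IntegrableOn f fund := by
  have hm := meas_of_contOn hS hSc hf
  have : LocallyIntegrable f volume := by
    intro z
    refine int_at hm ?_
    by_cases hz : z ∈ S
    · exact hb z hz
    · have hc := (hf.continuousAt (hS.isOpen_compl.mem_nhds hz)).abs
      refine ⟨|f z| + 1, ?_⟩
      have := (hc.tendsto.mono_left (nhdsWithin_le_nhds (s := {z}ᶜ))).eventually_lt_const (lt_add_one |f z|)
      filter_upwards [this] with x hx using hx.le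
  exact (this.integrableOn_isCompact (isCompact_closedBall (0 : Pl) 2)).mono_set fund_subset

/-- peak limit -/
theorem peak_limit {p : Pl} {H : Pl → ℝ} {L : ℝ} (hm : AEStronglyMeasurable H volume)
    (hH : Tendsto H (𝓝[≠] p) (𝓝 L)) {δ : ℕ → ℝ} (hδ : ∀ n, 0 < δ n) (hδ0 : Tendsto δ atTop (𝓝 0)) :
    Tendsto (fun n => ∫ x in ball p (1 / 2), phi (δ n) (x - p) * H x) atTop (𝓝 (2 * π * L)) := by
  have hint : IntegrableAtFilter H (𝓝 p) volume := by
    refine int_at hm ⟨|L| + 1, ?_⟩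
    filter_upwards [hH.abs.eventually_lt_const (lt_add_one |L|)] with x hx using hx.le
  obtain ⟨t, ht, hHt⟩ := hint
  obtain ⟨ρ', hρ', hsub⟩ := Metric.mem_nhds_iff.1 ht
  set ρ := min ρ' (1 / 2) with hρd
  have hρ : 0 < ρ := lt_min hρ' (by norm_num)
  have hHρ : IntegrableOn H (ball p ρ) := hHt.mono_set ((ball_subset_ball (min_le_left _ _)).trans hsub)
  set s : Set Pl := ball p ρ \ {p} with hs
  have hsm : MeasurableSet s := measurableSet_ball.diff (measurableSet_singleton p)
  have hsae : s =ᵐ[volume] ball p ρ := sdiff_null_ae_eq_self (by simp)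
  have hsupp : ∀ (r : ℝ), 0 < r → ∀ᶠ n in atTop, ∀ x : Pl, x ∉ ball p r → phi (δ n) (x - p) = 0 := by
    intro r hr
    filter_upwards [hδ0.eventually_lt_const (show (0:ℝ) < r ^ 2 by positivity)] with n hn x hx
    refine phi_zero (hδ n) ?_
    have : r ≤ ‖x - p‖ := by
      rw [mem_ball, dist_eq_norm, not_lt] at hx; exact hx
    calc δ n ≤ r ^ 2 := hn.le
      _ ≤ _ := by gcongr
  have hpeak := tendsto_setIntegral_peak_smul_of_integrableOn_of_tendsto
    (μ := (volume : Measure Pl)) (s := s) (t := s) (x₀ := p) (a := L) (g := H) (l := atTop)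
    (φ := fun n x => (2 * π)⁻¹ * phi (δ n) (x - p)) hsm hsm Subset.rfl self_mem_nhdsWithin
    (by rw [measure_congr hsae]; exact measure_ball_lt_top.ne)
    (Eventually.of_forall fun n x _ => mul_nonneg (by positivity) (phi_nonneg (hδ n) _))
    (by
      intro U hU hpU
      obtain ⟨r, hr, hrU⟩ := Metric.isOpen_iff.1 hU p hpU
      rw [Metric.tendstoUniformlyOn_iff]
      intro ε hε
      filter_upwards [hsupp r hr] with n hn x hx
      rw [hn x (fun h => hx.2 (hrU h))]
      simpa using hε)
    (by
      refine tendsto_const_nhds.congr' ?_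
      filter_upwards [hsupp ρ hρ] with n hn
      rw [setIntegral_congr_set hsae, setIntegral_eq_integral_of_forall_compl_eq_zero
        (fun x hx => by rw [hn x hx, mul_zero]), integral_const_mul,
        integral_sub_right_eq_self (phi (δ n)) p, phi_integral (hδ n)]
      field_simp)
    (Eventually.of_forall fun n => by
      have := phi_cont (δ n)
      exact (by fun_prop : Continuous fun x : Pl => (2 * π)⁻¹ * phi (δ n) (x - p)).aestronglyMeasurable)
    (hHρ.mono_set sdiff_subset)
    (hH.mono_left (nhdsWithin_mono _ (fun x hx => hx.2)))
  refine (hpeak.const_mul (2 * π)).congr' ?_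
  filter_upwards [hsupp ρ hρ] with n hn
  rw [setIntegral_congr_set hsae, ← integral_const_mul]
  have h1 : ∫ x in ball p (1 / 2), phi (δ n) (x - p) * H x = ∫ x in ball p ρ, phi (δ n) (x - p) * H x := by
    refine setIntegral_eq_of_subset_of_forall_sdiff_eq_zero measurableSet_ball
      (ball_subset_ball (min_le_right _ _)) ?_
    intro x hx
    rw [hn x hx.2, zero_mul]
  rw [h1]
  refine integral_congr_ae (Eventually.of_forall fun x => ?_)
  simp only [smul_eq_mul]
  field_simp

/-- unfolding to a ball -/
theorem unfold_ball {p : Pl} {δ : ℝ} (hδ : 0 < δ) (hδ' : δ < 1 / 4) (W : Fin 2 → Pl → ℝ)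
    (hper : ∀ i, Periodic2 (W i)) :
    ∫ x in fund, (-∑ i, pd (bb p δ) i x * W i x) =
      ∫ x in ball p (1 / 2), phi δ (x - p) * ∑ i, (x i - p i) * W i x := by
  have hP : Periodic2 (fun x => -∑ i, pd (bb p δ) i x * W i x) := by
    intro x v hv
    simp only [pd_per (bb_per p δ) _ x v hv, hper _ x v hv]
  rw [periodic_integral hP (p - WithLp.toLp 2 fun _ => 1 / 2)]
  have hset : ∀ x : Pl, x - (p - WithLp.toLp 2 fun _ => (1:ℝ) / 2) ∈ fund ↔
      ∀ i, x i - p i ∈ Ico (-(1:ℝ) / 2) (1 / 2) := by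
    intro x
    simp only [fund, mem_ofPred_eq, Fin.forall_fin_two, PiLp.sub_apply, mem_Ico]
    constructor <;> rintro ⟨⟨h1, h2⟩, ⟨h3, h4⟩⟩ <;> refine ⟨⟨?_, ?_⟩, ⟨?_, ?_⟩⟩ <;> linarith
  have hm : MeasurableSet {x : Pl | x - (p - WithLp.toLp 2 fun _ => (1:ℝ) / 2) ∈ fund} := by
    have : Measurable (fun x : Pl => x - (p - WithLp.toLp 2 fun _ => (1:ℝ) / 2)) := by fun_prop
    exact this fund_meas
  rw [setIntegral_eq_of_subset_of_forall_sdiff_eq_zero (s := ball p (1 / 2)) hm]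
  · refine setIntegral_congr_fun measurableSet_ball fun x hx => ?_
    have hx' : ‖x - p‖ < 1 / 2 := by rwa [mem_ball, dist_eq_norm] at hx
    simp only [bb_pd (self_lat p) hx', Fin.sum_univ_two]
    ring
  · intro x hx
    refine (hset x).2 fun i => ?_
    have hx' : ‖x - p‖ < 1 / 2 := by rwa [mem_ball, dist_eq_norm] at hx
    have h1 := (abs_coord_le (x - p) i).trans_lt hx'
    rw [abs_lt] at h1
    simp only [PiLp.sub_apply] at h1
    constructor <;> linarith [h1.1, h1.2]
  · rintro x ⟨hx1, hx2⟩
    have hx1 := (hset x).1 hx1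
    have hx2 : ¬ ‖x - p‖ < 1 / 2 := by rwa [mem_ball, dist_eq_norm] at hx2
    have : ∀ i, pd (bb p δ) i x = 0 := by
      rcases lt_or_ge (dl p x) (1 / 2) with h' | h'
      · exfalso
        obtain ⟨z, hz, hxz⟩ := dl_near h'
        have : z - p = 0 := uL_small hz (fun i => by
          have h1 := (abs_coord_le (x - z) i).trans_lt hxz
          rw [abs_lt] at h1 ⊢
          simp only [PiLp.sub_apply] at h1 ⊢
          have h2 := hx1 i
          constructor <;> linarith [h1.1, h1.2, h2.1, h2.2])
        rw [sub_eq_zero.1 this] at hxz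
        exact hx2 hxz
      · exact bb_pd_zero hδ hδ' h'
    simp [this]

theorem exists_sep {J : Type} [Fintype J] (P : J → Pl) (hP : ∀ i j, i ≠ j → P i ∉ lat (P j)) :
    ∃ R : ℝ, 0 < R ∧ R ≤ 1 / 2 ∧ ∀ x i j, dl (P i) x < R → dl (P j) x < R → i = j := by
  have h1 : ∀ᶠ R in 𝓝[>] (0:ℝ), ∀ i j, i ≠ j → 2 * R < dl (P j) (P i) := by
    rw [eventually_all]; intro i
    rw [eventually_all]; intro j
    by_cases hij : i = j
    · exact Eventually.of_forall fun R h => absurd hij h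
    · have hc : Tendsto (fun R : ℝ => 2 * R) (𝓝[>] 0) (𝓝 0) := by
        have : Continuous (fun R : ℝ => 2 * R) := by fun_prop
        have := this.tendsto 0
        rw [mul_zero] at this
        exact this.mono_left nhdsWithin_le_nhds
      filter_upwards [hc.eventually_lt_const (dl_pos (hP i j hij))] with R hR _ using hR
  have h2 : ∀ᶠ R in 𝓝[>] (0:ℝ), R < 1 / 2 :=
    mem_nhdsWithin_of_mem_nhds (Iio_mem_nhds (by norm_num))
  have h3 : ∀ᶠ R in 𝓝[>] (0:ℝ), 0 < R := self_mem_nhdsWithin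
  obtain ⟨R, ⟨hR1, hR2⟩, hR3⟩ := ((h1.and h2).and h3).exists
  refine ⟨R, hR3, hR2.le, fun x i j hi hj => ?_⟩
  by_contra hij
  have h4 := hR1 i j hij
  obtain ⟨z, hz, hxz⟩ := dl_near hi
  have h5 : dl (P j) z = dl (P j) (P i) := by
    have := dl_per (P j) (P i) (z - P i) hz
    rwa [show P i + (z - P i) = z by abel] at this
  have h6 : dl (P j) z ≤ dl (P j) x + dist z x := infDist_le_infDist_add_dist
  rw [dist_comm, dist_eq_norm] at h6
  linarith

/-- the cutoff -/
def chi {J : Type} [Fintype J] (P : J → Pl) (δ : ℝ) (x : Pl) : ℝ := 1 - ∑ j, bb (P j) δ x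

section
variable {J : Type} [Fintype J] {P : J → Pl} {R δ : ℝ}

theorem chi_cont (P : J → Pl) (δ : ℝ) : Continuous (chi P δ) := by
  unfold chi
  exact continuous_const.sub (continuous_finsetSum _ fun j _ => bb_cont (P j) δ)

theorem chi_per (P : J → Pl) (δ : ℝ) : Periodic2 (chi P δ) := by
  intro x v hv
  simp only [chi, bb_per _ δ x v hv]

theorem chi_nonneg (hR0 : 0 < R) (hR : ∀ x i j, dl (P i) x < R → dl (P j) x < R → i = j)
    (hδ : 0 < δ) (hδR : δ ≤ R ^ 2) (x : Pl) : 0 ≤ chi P δ x := by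
  unfold chi
  by_cases h : ∃ j, dl (P j) x < R
  · obtain ⟨j, hj⟩ := h
    rw [Finset.sum_eq_single j]
    · linarith [bb_le_one (p := P j) (x := x) hδ]
    · intro k _ hk
      refine bb_zero hδ (hδR.trans ?_)
      have : R ≤ dl (P k) x := by
        by_contra! h; exact hk (hR x k j h hj)
      gcongr
    · simp
  · push Not at h
    rw [Finset.sum_eq_zero]
    · norm_num
    · intro k _
      refine bb_zero hδ (hδR.trans ?_)
      have := h k
      gcongr

theorem chi_le_one (x : Pl) : chi P δ x ≤ 1 := by
  unfold chi
  have := Finset.sum_nonneg (s := Finset.univ) fun j _ => bb_nonneg (P j) x δ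
  linarith

theorem chi_le (hδ : 0 < δ) {j : J} {z : Pl} (hz : z ∈ lat (P j)) (x : Pl) :
    chi P δ x ≤ 2 / δ * ‖x - z‖ ^ 2 := by
  unfold chi
  have h1 := Finset.single_le_sum (s := Finset.univ) (f := fun j => bb (P j) δ x)
    (fun j _ => bb_nonneg (P j) x δ) (Finset.mem_univ j)
  have h2 := bb_lower (p := P j) (x := x) hδ
  have h3 : dl (P j) x ^ 2 ≤ ‖x - z‖ ^ 2 := by
    have := dl_le (x := x) hz
    have := dl_nonneg (P j) x
    gcongr
  calc 1 - ∑ j, bb (P j) δ x ≤ 2 * dl (P j) x ^ 2 / δ := by linarith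
    _ = 2 / δ * dl (P j) x ^ 2 := by ring
    _ ≤ _ := by gcongr

theorem chi_mono {δ' : ℝ} (hδ : 0 < δ) (h : δ ≤ δ') (x : Pl) : chi P δ' x ≤ chi P δ x := by
  unfold chi
  have := Finset.sum_le_sum (s := Finset.univ) fun j _ => bb_mono (p := P j) (x := x) hδ h
  linarith

theorem chi_deriv (hδ : 0 < δ) (hδ' : δ < 1 / 4) (x : Pl) :
    DifferentiableAt ℝ (chi P δ) x := by
  unfold chi
  exact (differentiableAt_const _).sub (DifferentiableAt.fun_sum fun j _ => bb_diff hδ hδ')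

theorem chi_pd (hδ : 0 < δ) (hδ' : δ < 1 / 4) (x : Pl) (i : Fin 2) :
    pd (chi P δ) i x = -∑ j, pd (bb (P j) δ) i x := by
  have h1 : HasFDerivAt (chi P δ) (-∑ j, fderiv ℝ (bb (P j) δ) x) x :=
    (HasFDerivAt.fun_sum fun j _ => (bb_diff (p := P j) (x := x) hδ hδ').hasFDerivAt).const_sub 1
  rw [pd_of i h1]
  simp only [neg_apply, sum_apply]
  congr 1
  exact Finset.sum_congr rfl fun j _ => (pd_eq i (bb_diff hδ hδ')).symm

end

theorem pd_mul {f g : Pl → ℝ} {x : Pl} (i : Fin 2) (hf : DifferentiableAt ℝ f x)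
    (hg : DifferentiableAt ℝ g x) :
    pd (fun y => f y * g y) i x = pd f i x * g x + f x * pd g i x := by
  have h : HasFDerivAt (fun y => f y * g y) _ x := hf.hasFDerivAt.mul hg.hasFDerivAt
  rw [pd_of i h, pd_eq i hf, pd_eq i hg]
  simp
  ring

theorem core {J : Type} [Fintype J] (P : J → Pl) (hP : ∀ i j, i ≠ j → P i ∉ lat (P j))
    (S : Set Pl) (hS : S = ⋃ j, lat (P j)) (W : Fin 2 → Pl → ℝ) (hper : ∀ i, Periodic2 (W i))
    (hdiff : ∀ x ∉ S, ∀ i, DifferentiableAt ℝ (W i) x) (I : Pl → ℝ) (hIc : ContinuousOn I Sᶜ)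
    (hI0 : ∀ x ∉ S, 0 ≤ I x) (hdiv : ∀ x ∉ S, ∑ i, pd (W i) i x = - I x)
    (hb : ∀ z ∈ S, ∃ C, 0 ≤ C ∧ ∀ᶠ x in 𝓝[≠] z,
      (∀ i, ‖x - z‖ * |W i x| ≤ C) ∧ ‖x - z‖ ^ 2 * |I x| ≤ C)
    (L : J → ℝ) (hL : ∀ j, Tendsto (fun x => ∑ i, (x i - P j i) * W i x) (𝓝[≠] P j) (𝓝 (L j))) :
    ∫ x in fund, I x = 2 * π * ∑ j, L j := by
  have hScl : IsClosed S := by rw [hS]; exact isClosed_iUnion_of_finite fun j => lat_closed _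
  have hSct : S.Countable := by rw [hS]; exact countable_iUnion fun j => lat_countable _
  have hSae : ∀ᵐ x ∂(volume : Measure Pl), x ∉ S :=
    measure_eq_zero_iff_ae_notMem.1 (hSct.measure_zero volume)
  have hlS : ∀ z ∈ S, ∃ j, z ∈ lat (P j) := by
    intro z hz; rw [hS] at hz; simpa using hz
  have hWc : ∀ i, ContinuousOn (W i) Sᶜ := fun i x hx =>
    (hdiff x hx i).continuousAt.continuousWithinAt
  obtain ⟨R, hR0, hR12, hR⟩ := exists_sep P hP
  -- fixed δ
  have step : ∀ δ : ℝ, 0 < δ → δ < R ^ 2 →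
      IntegrableOn (fun x => chi P δ x * I x) fund ∧
      ∫ x in fund, chi P δ x * I x =
        ∑ j, ∫ x in ball (P j) (1 / 2), phi δ (x - P j) * ∑ i, (x i - P j i) * W i x := by
    intro δ hδ hδR
    have hδ4 : δ < 1 / 4 := by nlinarith
    have hnn := chi_nonneg hR0 hR hδ hδR.le
    have hint1 : IntegrableOn (fun x => chi P δ x * I x) fund := by
      refine int_fund hScl hSct ((chi_cont P δ).continuousOn.mul hIc) fun z hz => ?_
      obtain ⟨j, hj⟩ := hlS z hz
      obtain ⟨C, hC0, hC⟩ := hb z hz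
      refine ⟨2 / δ * C, ?_⟩
      filter_upwards [hC] with x hx
      rw [abs_mul, abs_of_nonneg (hnn x)]
      calc chi P δ x * |I x| ≤ (2 / δ * ‖x - z‖ ^ 2) * |I x| := by
            gcongr; exact chi_le hδ hj x
        _ = 2 / δ * (‖x - z‖ ^ 2 * |I x|) := by ring
        _ ≤ _ := by gcongr; exact hx.2
    have hint2 : ∀ j, IntegrableOn (fun x => -∑ i, pd (bb (P j) δ) i x * W i x) fund := by
      intro j
      refine int_fund hScl hSct ?_ fun z hz => ?_
      · exact (continuousOn_finsetSum _ fun i _ =>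
          (bb_pd_cont hδ hδ4 i).continuousOn.mul (hWc i)).neg
      obtain ⟨k, hk⟩ := hlS z hz
      obtain ⟨C, hC0, hC⟩ := hb z hz
      have hnear : ∀ᶠ x in 𝓝[≠] z, ‖x - z‖ < R := by
        refine mem_nhdsWithin_of_mem_nhds ?_
        filter_upwards [ball_mem_nhds z hR0] with x hx
        rwa [mem_ball, dist_eq_norm] at hx
      by_cases hjk : j = k
      · subst hjk
        refine ⟨∑ _i : Fin 2, 4 / δ * C, ?_⟩
        filter_upwards [hC, hnear] with x hx hxR
        rw [abs_neg]
        refine (Finset.abs_sum_le_sum_abs _ _).trans (Finset.sum_le_sum fun i _ => ?_)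
        rw [bb_pd hk (hxR.trans_le hR12), abs_mul, abs_mul, abs_neg, abs_of_nonneg (phi_nonneg hδ _)]
        have h1 : |x i - z i| ≤ ‖x - z‖ := by simpa using abs_coord_le (x - z) i
        calc phi δ (x - z) * |x i - z i| * |W i x| ≤ 4 / δ * ‖x - z‖ * |W i x| := by
              gcongr; exact phi_le hδ _
          _ = 4 / δ * (‖x - z‖ * |W i x|) := by ring
          _ ≤ _ := by gcongr; exact hx.1 i
      · refine ⟨0, ?_⟩
        filter_upwards [hnear] with x hxR
        have h1 : R ≤ dl (P j) x := by
          by_contra! h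
          exact hjk (hR x j k h ((dl_le hk).trans_lt hxR))
        have h2 : ∀ i, pd (bb (P j) δ) i x = 0 :=
          bb_pd_zero' hδ hδ4 (hδR.le.trans (by gcongr))
        simp [h2]
    refine ⟨hint1, ?_⟩
    -- divergence
    have hpt : ∀ x ∉ S, ∑ i, pd (fun y => chi P δ y * W i y) i x =
        (∑ j, (-∑ i, pd (bb (P j) δ) i x * W i x)) - chi P δ x * I x := by
      intro x hx
      simp only [fun i => pd_mul i (chi_deriv (P := P) hδ hδ4 x) (hdiff x hx i)]
      rw [Finset.sum_add_distrib, ← Finset.mul_sum, hdiv x hx]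
      simp only [chi_pd hδ hδ4]
      rw [Finset.sum_neg_distrib, Finset.sum_comm]
      simp only [neg_mul, Finset.sum_mul, Finset.sum_neg_distrib]
      ring
    have hae : (fun x => ∑ i, pd (fun y => chi P δ y * W i y) i x) =ᵐ[volume.restrict fund]
        fun x => (∑ j, (-∑ i, pd (bb (P j) δ) i x * W i x)) - chi P δ x * I x := by
      filter_upwards [ae_restrict_of_ae hSae] with x hx using hpt x hx
    have hsumint : IntegrableOn (fun x => ∑ j, (-∑ i, pd (bb (P j) δ) i x * W i x)) fund :=
      integrable_finsetSum _ fun j _ => hint2 j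
    have hz := div_zero_int (fun i y => chi P δ y * W i y) (fun i x v hv => by
        simp only [chi_per P δ x v hv, hper i x v hv])
      (by
        intro i
        rw [continuous_iff_continuousAt]
        intro z
        by_cases hz : z ∈ S
        · obtain ⟨j, hj⟩ := hlS z hz
          obtain ⟨C, hC0, hC⟩ := hb z hz
          have hchi0 : chi P δ z = 0 := by
            refine le_antisymm ?_ (hnn z)
            simpa using chi_le hδ hj z
          rw [continuousAt_iff_punctured_nhds, hchi0, zero_mul]
          have hlim : Tendsto (fun x : Pl => 2 / δ * C * ‖x - z‖) (𝓝[≠] z) (𝓝 0) := by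
            have hc : Continuous (fun x : Pl => 2 / δ * C * ‖x - z‖) := by fun_prop
            have := hc.tendsto z
            simp only [sub_self, norm_zero, mul_zero] at this
            exact this.mono_left nhdsWithin_le_nhds
          refine squeeze_zero_norm' ?_ hlim
          filter_upwards [hC] with x hx
          rw [norm_mul, Real.norm_eq_abs, Real.norm_eq_abs, abs_of_nonneg (hnn x)]
          calc chi P δ x * |W i x| ≤ (2 / δ * ‖x - z‖ ^ 2) * |W i x| := by
                gcongr; exact chi_le hδ hj x
            _ = 2 / δ * (‖x - z‖ * |W i x|) * ‖x - z‖ := by ring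
            _ ≤ _ := by gcongr; exact hx.1 i
        · exact (chi_cont P δ).continuousAt.mul (hdiff z hz i).continuousAt)
      S hSct (fun x hx i => (chi_deriv hδ hδ4 x).mul (hdiff x hx i))
      ((hsumint.sub hint1).congr hae.symm)
    rw [integral_congr_ae hae, integral_sub hsumint hint1, sub_eq_zero,
      integral_finsetSum _ fun j _ => hint2 j] at hz
    rw [← hz]
    exact Finset.sum_congr rfl fun j _ => unfold_ball hδ hδ4 W hper
  -- limit
  set δ : ℕ → ℝ := fun n => R ^ 2 / ((n : ℝ) + 2) with hδdef
  have hδ : ∀ n, 0 < δ n := fun n => by simp only [hδdef]; positivity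
  have hδR : ∀ n, δ n < R ^ 2 := fun n => by
    simp only [hδdef]
    rw [div_lt_iff₀ (by positivity)]
    have : (0:ℝ) ≤ n := by positivity
    nlinarith [pow_pos hR0 2]
  have hδanti : ∀ m n, m ≤ n → δ n ≤ δ m := fun m n h => by
    simp only [hδdef]
    gcongr
  have hδ0 : Tendsto δ atTop (𝓝 0) :=
    tendsto_const_nhds.div_atTop (tendsto_atTop_add_const_right _ _ tendsto_natCast_atTop_atTop)
  have hlim : Tendsto (fun n => ∫ x in fund, chi P (δ n) x * I x) atTop (𝓝 (2 * π * ∑ j, L j)) := by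
    simp only [fun n => (step (δ n) (hδ n) (hδR n)).2]
    rw [Finset.mul_sum]
    refine tendsto_finsetSum _ fun j _ => peak_limit ?_ (hL j) hδ hδ0
    refine meas_of_contOn hScl hSct (continuousOn_finsetSum _ fun i _ => ?_)
    exact (by fun_prop : Continuous fun x : Pl => x i - P j i).continuousOn.mul (hWc i)
  have hIm : AEStronglyMeasurable I (volume.restrict fund) := (meas_of_contOn hScl hSct hIc).restrict
  have hSae' : ∀ᵐ x ∂(volume.restrict fund), x ∉ S := ae_restrict_of_ae hSae
  have hInn : 0 ≤ᵐ[volume.restrict fund] I := by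
    filter_upwards [hSae'] with x hx using hI0 x hx
  have hmct : Tendsto (fun n => ∫⁻ x in fund, ENNReal.ofReal (chi P (δ n) x * I x)) atTop
      (𝓝 (∫⁻ x in fund, ENNReal.ofReal (I x))) := by
    refine lintegral_tendsto_of_tendsto_of_monotone
      (fun n => (step (δ n) (hδ n) (hδR n)).1.aestronglyMeasurable.aemeasurable.ennreal_ofReal) ?_ ?_
    · filter_upwards [hSae'] with x hx m n hmn
      refine ENNReal.ofReal_le_ofReal (mul_le_mul_of_nonneg_right ?_ (hI0 x hx))
      exact chi_mono (hδ n) (hδanti m n hmn) x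
    · filter_upwards [hSae'] with x hx
      refine tendsto_const_nhds.congr' ?_
      have : ∀ᶠ n in atTop, ∀ j, bb (P j) (δ n) x = 0 := by
        rw [eventually_all]
        intro j
        have hxj : x ∉ lat (P j) := fun h => hx (by rw [hS]; exact mem_iUnion.2 ⟨j, h⟩)
        have hpos := dl_pos hxj
        filter_upwards [hδ0.eventually_lt_const (show 0 < dl (P j) x ^ 2 by positivity)] with n hn
        exact bb_zero (hδ n) hn.le
      filter_upwards [this] with n hn
      simp [chi, hn]
  have heq : ∀ n, ∫⁻ x in fund, ENNReal.ofReal (chi P (δ n) x * I x) =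
      ENNReal.ofReal (∫ x in fund, chi P (δ n) x * I x) := by
    intro n
    rw [ofReal_integral_eq_lintegral_ofReal (step (δ n) (hδ n) (hδR n)).1]
    filter_upwards [hSae'] with x hx
    exact mul_nonneg (chi_nonneg hR0 hR (hδ n) (hδR n).le x) (hI0 x hx)
  simp only [heq] at hmct
  have hfin := tendsto_nhds_unique hmct (ENNReal.tendsto_ofReal hlim)
  rw [integral_eq_lintegral_of_nonneg_ae hInn hIm, hfin, ENNReal.toReal_ofReal]
  refine ge_of_tendsto' hlim fun n => ?_
  refine integral_nonneg_of_ae ?_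
  filter_upwards [hSae'] with x hx
  exact mul_nonneg (chi_nonneg hR0 hR (hδ n) (hδR n).le x) (hI0 x hx)

theorem gg_deriv {a : ℝ} (ha : 0 < a) (t : ℝ) :
    HasDerivAt (gg a) (-((a + 1) * exp t / (a + exp t) ^ 2)) t := by
  have hE := exp_pos t
  have hne : a + exp t ≠ 0 := by positivity
  have h := ((Real.hasDerivAt_exp t).const_sub 1).div ((Real.hasDerivAt_exp t).const_add a) hne
  refine HasDerivAt.congr_deriv h ?_
  field_simp
  ring

theorem Z_eq (V : VortexData) : V.Z = ⋃ j : Fin V.d₁ ⊕ Fin V.d₂, lat (Sum.elim V.p₁ V.p₂ j) := by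
  have hl : ∀ p x : Pl, (∃ v, v ∈ unitLattice ∧ x = p + v) ↔ x ∈ lat p := by
    intro p x
    rw [mem_lat]
    constructor
    · rintro ⟨v, hv, rfl⟩; simpa using hv
    · intro h; exact ⟨x - p, h, by abel⟩
  ext x
  simp only [VortexData.Z, VortexData.Z1, VortexData.Z2, mem_union, mem_ofPred_eq, mem_iUnion,
    Sum.exists, Sum.elim_inl, Sum.elim_inr, hl]

/-- **identity (2.12).** For every solution `u` of `(E_ε)` and every
`a ∈ (0,∞)`:
`∫_Ω (a+1)|∇u|² e^u/(a+e^u)² + ε⁻² e^u (1−e^u)²/((τ+e^u)³(a+e^u)) dx = 4π(N₁/a + N₂)`. -/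
theorem integral_identity
    (V : VortexData) (τ : ℝ) (hτ : 0 < τ)
    (ε : ℝ) (hε : 0 < ε) (u : Pl → ℝ) (hu : IsSolution V τ ε u) :
    ∀ a : ℝ, 0 < a →
      (∫ x in fund,
        ((a + 1) * gradSq u x * exp (u x) / (a + exp (u x)) ^ 2 +
          (ε ^ 2)⁻¹ * exp (u x) * (1 - exp (u x)) ^ 2 /
            ((τ + exp (u x)) ^ 3 * (a + exp (u x)))))
        = 4 * π * (V.N1 / a + V.N2) := by
  intro a ha
  set P : Fin V.d₁ ⊕ Fin V.d₂ → Pl := Sum.elim V.p₁ V.p₂ with hPdef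
  have hP : ∀ i j, i ≠ j → P i ∉ lat (P j) := by
    intro i j hij h
    exact V.distinct i j hij _ h (by simp [hPdef])
  have hZ : V.Z = ⋃ j, lat (P j) := Z_eq V
  have hZcl : IsClosed V.Z := by rw [hZ]; exact isClosed_iUnion_of_finite fun j => lat_closed _
  have hsm : ∀ x ∉ V.Z, ContDiffAt ℝ (⊤ : ℕ∞) u x := fun x hx =>
    (hu.smooth x hx).contDiffAt (hZcl.isOpen_compl.mem_nhds hx)
  have hud : ∀ x ∉ V.Z, DifferentiableAt ℝ u x := fun x hx => (hsm x hx).differentiableAt (by simp)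
  have hpdd : ∀ x ∉ V.Z, ∀ i, DifferentiableAt ℝ (pd u i) x := by
    intro x hx i
    have h1 : ContDiffAt ℝ 1 (fderiv ℝ u) x :=
      (hsm x hx).fderiv_right (m := 1) (WithTop.coe_le_coe.2 (le_top : ((1:ℕ∞)+1) ≤ ⊤))
    have h2 : DifferentiableAt ℝ (fun y => fderiv ℝ u y (EuclideanSpace.single i 1)) x :=
      (h1.differentiableAt (by simp)).clm_apply (differentiableAt_const _)
    refine h2.congr_of_eventuallyEq ?_
    filter_upwards [hZcl.isOpen_compl.mem_nhds hx] with y hy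
    exact pd_eq i (hud y hy)
  have hgd : ∀ x ∉ V.Z, HasFDerivAt (fun y => gg a (u y))
      (-((a + 1) * exp (u x) / (a + exp (u x)) ^ 2) • fderiv ℝ u x) x := fun x hx =>
    (gg_deriv ha (u x)).comp_hasFDerivAt x (hud x hx).hasFDerivAt
  have huc : ContinuousOn u V.Zᶜ := fun x hx => (hud x hx).continuousAt.continuousWithinAt
  have hpc : ∀ i, ContinuousOn (pd u i) V.Zᶜ := fun i x hx =>
    (hpdd x hx i).continuousAt.continuousWithinAt
  have hec : ContinuousOn (fun x => exp (u x)) V.Zᶜ := huc.rexp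
  have hsing : ∀ z ∈ V.Z, ∃ α, LogSing u z α := by
    intro z hz
    rw [hZ] at hz
    obtain ⟨j, hj⟩ := mem_iUnion.1 hz
    rcases j with j | j
    · exact ⟨_, (hu.sing₁ j).translate hu.periodic hj⟩
    · exact ⟨_, (hu.sing₂ j).translate hu.periodic hj⟩
  have key := core P hP V.Z hZ (fun i x => gg a (u x) * pd u i x)
    (fun i x v hv => by simp only [hu.periodic x v hv, pd_per hu.periodic i x v hv])
    (fun x hx i => (hgd x hx).differentiableAt.mul (hpdd x hx i))
    (fun x => (a + 1) * gradSq u x * exp (u x) / (a + exp (u x)) ^ 2 +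
          (ε ^ 2)⁻¹ * exp (u x) * (1 - exp (u x)) ^ 2 /
            ((τ + exp (u x)) ^ 3 * (a + exp (u x))))
    (by
      have hg : ContinuousOn (gradSq u) V.Zᶜ := ((hpc 0).pow 2).add ((hpc 1).pow 2)
      refine ContinuousOn.add (ContinuousOn.div ?_ ?_ ?_) (ContinuousOn.div ?_ ?_ ?_)
      · fun_prop
      · fun_prop
      · intro x _; have := exp_pos (u x); positivity
      · fun_prop
      · fun_prop
      · intro x _; have := exp_pos (u x); positivity)
    (by
      intro x _
      have := exp_pos (u x)
      have : 0 ≤ gradSq u x := by unfold gradSq; positivity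
      positivity)
    (by
      intro x hx
      have hE := exp_pos (u x)
      have hpg : ∀ i, pd (fun y => gg a (u y)) i x =
          -((a + 1) * exp (u x) / (a + exp (u x)) ^ 2) * pd u i x := by
        intro i
        rw [pd_of i (hgd x hx), pd_eq i (hud x hx)]; simp
      have hlap := hu.pde x hx
      simp only [fun i => pd_mul i (hgd x hx).differentiableAt (hpdd x hx i), hpg, Fin.sum_univ_two]
      unfold lap fτ at hlap
      have h00 : pd (pd u 0) 0 x = -pd (pd u 1) 1 x - (ε ^ 2)⁻¹ *
        (exp (u x) * (1 - exp (u x)) / (τ + exp (u x)) ^ 3) := by linarith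
      rw [h00]
      unfold gradSq gg
      have h1 : a + exp (u x) ≠ 0 := by positivity
      have h2 : τ + exp (u x) ≠ 0 := by positivity
      field_simp
      ring)
    (by
      intro z hz
      obtain ⟨α, hα⟩ := hsing z hz
      obtain ⟨C, hC0, hC⟩ := sing_bound hα
      have hK : 0 ≤ (1 + 1 / a) * C := by positivity
      set B : ℝ := (a + 1) * (2 * C ^ 2) * (1 / a) + (ε ^ 2)⁻¹ * ((1 + 1 / τ) ^ 2 * (1 / a)) with hB
      have hB0 : 0 ≤ B := by positivity
      refine ⟨max ((1 + 1 / a) * C) B, le_max_of_le_left hK, ?_⟩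
      filter_upwards [hC, mem_nhdsWithin_of_mem_nhds (ball_mem_nhds z one_pos)] with x hx hball
      have hlt : ‖x - z‖ < 1 := by rwa [mem_ball, dist_eq_norm] at hball
      have hE := exp_pos (u x)
      constructor
      · intro i
        refine le_max_of_le_left ?_
        rw [abs_mul]
        calc ‖x - z‖ * (|gg a (u x)| * |pd u i x|) = |gg a (u x)| * (‖x - z‖ * |pd u i x|) := by ring
          _ ≤ _ := by
            gcongr
            · exact gg_bound ha _
            · exact hx i
      · refine le_max_of_le_right ?_
        have hgr : ‖x - z‖ ^ 2 * gradSq u x ≤ 2 * C ^ 2 := by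
          have h0 : (‖x - z‖ * |pd u 0 x|) ^ 2 ≤ C ^ 2 := by gcongr; exact hx 0
          have h1 : (‖x - z‖ * |pd u 1 x|) ^ 2 ≤ C ^ 2 := by gcongr; exact hx 1
          rw [mul_pow, sq_abs] at h0 h1
          unfold gradSq
          linarith
        have hg0 : 0 ≤ gradSq u x := by unfold gradSq; positivity
        have hq1 : exp (u x) / (a + exp (u x)) ^ 2 ≤ 1 / a := by
          rw [div_le_div_iff₀ (by positivity) ha]
          nlinarith [mul_pos ha hE, sq_nonneg a, sq_nonneg (exp (u x))]
        have hq2 : exp (u x) * (1 - exp (u x)) ^ 2 / ((τ + exp (u x)) ^ 3 * (a + exp (u x))) ≤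
            (1 + 1 / τ) ^ 2 * (1 / a) := by
          have e1 : exp (u x) * (1 - exp (u x)) ^ 2 / ((τ + exp (u x)) ^ 3 * (a + exp (u x))) =
              |gg τ (u x)| ^ 2 * (exp (u x) / (τ + exp (u x)) * (1 / (a + exp (u x)))) := by
            rw [sq_abs]
            unfold gg
            field_simp
          rw [e1]
          have e2 : exp (u x) / (τ + exp (u x)) ≤ 1 := by
            rw [div_le_one (by positivity)]; linarith
          have e3 : 1 / (a + exp (u x)) ≤ 1 / a := by
            apply one_div_le_one_div_of_le ha; linarith
          have e4 : exp (u x) / (τ + exp (u x)) * (1 / (a + exp (u x))) ≤ 1 / a := by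
            calc _ ≤ 1 * (1 / a) := by gcongr
              _ = _ := one_mul _
          gcongr
          exact gg_bound hτ _
        rw [abs_of_nonneg (by positivity)]
        have hsq : ‖x - z‖ ^ 2 ≤ 1 := pow_le_one₀ (norm_nonneg _) hlt.le
        calc _ = (a + 1) * (‖x - z‖ ^ 2 * gradSq u x) * (exp (u x) / (a + exp (u x)) ^ 2) +
              ‖x - z‖ ^ 2 * ((ε ^ 2)⁻¹ *
              (exp (u x) * (1 - exp (u x)) ^ 2 / ((τ + exp (u x)) ^ 3 * (a + exp (u x))))) := by ring
          _ ≤ (a + 1) * (2 * C ^ 2) * (1 / a) + 1 * ((ε ^ 2)⁻¹ * ((1 + 1 / τ) ^ 2 * (1 / a))) := by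
            gcongr
          _ = B := by rw [hB, one_mul])
    (Sum.elim (fun j => 2 * V.m₁ j / a) (fun j => 2 * V.m₂ j))
    (by
      intro j
      have hsw : ∀ x : Pl, ∑ i, (x i - P j i) * (gg a (u x) * pd u i x) =
          gg a (u x) * ∑ i, (x i - P j i) * pd u i x := by
        intro x
        rw [Finset.mul_sum]
        exact Finset.sum_congr rfl fun i _ => by ring
      simp only [hsw]
      rcases j with j | j
      · exact flux_one ha (V.m₁_nonneg j) (hu.sing₁ j)
      · exact flux_two ha (V.m₂_nonneg j) (hu.sing₂ j))
  rw [key, Fintype.sum_sum_type]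
  simp only [Sum.elim_inl, Sum.elim_inr, VortexData.N1, VortexData.N2, ← Finset.sum_div,
    ← Finset.mul_sum]
  ring
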